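/- Let G be a group acting on the unit circle S¹ by homeomorphisms, and let A be a nonempty closed G-invariant subset of S¹. Then either (i) A is countable and there exists a point a ∈ A whose G-orbit is finite (so G virtually fixes a point of A), or (ii) there exists a continuous surjection q : S¹ → S¹ such that every fiber q⁻¹({z}) is compact and connected, q(A) = S¹, and for every g ∈ G there is a homeomorphism φ_g : S¹ → S¹ with q ∘ (action of g) = φ_g ∘ q. -/

import Mathlib

open Pointwise

/-- The unit circle, modeled as the reals modulo `2π`. -/
abbrev S1 : Type := AddCircle (2 * Real.pi)

open Set MeasureTheory Filter Topology

/-- An uncountable Borel set of reals carries an atomless probability measure. -/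
lemma aux_measure (B : Set ℝ) (hB : MeasurableSet B) (hu : ¬ B.Countable) :
    ∃ μ : Measure ℝ, IsProbabilityMeasure μ ∧ (∀ x, μ {x} = 0) ∧ μ Bᶜ = 0 := by
  have : StandardBorelSpace B := hB.standardBorel
  have h1 : ¬ Countable B := fun h => hu (Set.countable_coe_iff.mp h)
  have h2 : ¬ Countable ℝ := not_countable
  let e : ℝ ≃ᵐ B := PolishSpace.measurableEquivOfNotCountable h2 h1
  let f : ℝ → ℝ := fun x => (e x : ℝ)
  have hf : Measurable f := measurable_subtype_coe.comp e.measurable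
  have hfi : Function.Injective f := Subtype.val_injective.comp e.injective
  let ν : Measure ℝ := volume.restrict (Ioc 0 1)
  have : IsProbabilityMeasure ν := ⟨by simp [ν]⟩
  refine ⟨ν.map f, Measure.isProbabilityMeasure_map hf.aemeasurable, fun x => ?_, ?_⟩
  · rw [Measure.map_apply hf (measurableSet_singleton x)]
    have : (f ⁻¹' {x}).Subsingleton := by
      intro a ha b hb
      exact hfi (ha.trans hb.symm)
    exact this.measure_zero ν
  · rw [Measure.map_apply hf hB.compl]
    have : f ⁻¹' Bᶜ = ∅ := by
      ext x
      simp [f]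
    rw [this]; simp

lemma aux_rat (B : Set ℝ) (a b : ℝ) (h : ¬ (Ioo a b ∩ B).Countable) :
    ∃ p : ℚ × ℚ, a < p.1 ∧ (p.2 : ℝ) < b ∧ ¬ (B ∩ Ioo (p.1 : ℝ) p.2).Countable := by
  by_contra hc
  push Not at hc
  apply h
  have : Ioo a b ∩ B ⊆ ⋃ p : {p : ℚ × ℚ // a < p.1 ∧ (p.2 : ℝ) < b},
      (B ∩ Ioo (p.1.1 : ℝ) p.1.2) := by
    rintro x ⟨⟨h1, h2⟩, hx⟩
    obtain ⟨p, hp1, hp2⟩ := exists_rat_btwn h1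
    obtain ⟨q, hq1, hq2⟩ := exists_rat_btwn h2
    exact mem_iUnion.2 ⟨⟨(p, q), hp1, hq2⟩, hx, hp2, hq1⟩
  refine Countable.mono this (countable_iUnion fun p => hc p.1 p.2.1 p.2.2)

lemma aux_measure2 (B : Set ℝ) (hB : MeasurableSet B) (hu : ¬ B.Countable) :
    ∃ μ : Measure ℝ, IsProbabilityMeasure μ ∧ (∀ x, μ {x} = 0) ∧ μ Bᶜ = 0 ∧
      ∀ a b : ℝ, μ (Ioc a b) = 0 ↔ (Ioo a b ∩ B).Countable := by
  have key : ∀ p : ℚ × ℚ, ∃ μ : Measure ℝ, μ univ ≤ 1 ∧ (∀ x, μ {x} = 0) ∧ μ Bᶜ = 0 ∧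
      (¬ (B ∩ Ioo (p.1 : ℝ) p.2).Countable → μ (Ioo (p.1 : ℝ) p.2) ≠ 0) := by
    intro p
    by_cases h : (B ∩ Ioo (p.1 : ℝ) p.2).Countable
    · exact ⟨0, by simp, by simp, by simp, fun h' => absurd h h'⟩
    · obtain ⟨μ, h1, h2, h3⟩ := aux_measure _ (hB.inter measurableSet_Ioo) h
      refine ⟨μ, prob_le_one, h2, measure_mono_null ?_ h3, fun _ h0 => ?_⟩
      · exact compl_subset_compl.2 inter_subset_left
      · have : μ univ = 0 := by
          rw [← union_compl_self (Ioo (p.1 : ℝ) p.2)]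
          refine measure_union_null h0 (measure_mono_null ?_ h3)
          exact compl_subset_compl.2 inter_subset_right
        simp at this
  choose μ h1 h2 h3 h4 using key
  obtain ⟨w, hw0, hw⟩ := ENNReal.exists_pos_sum_of_countable' (ε := 1) one_ne_zero (ℚ × ℚ)
  let m : Measure ℝ := Measure.sum fun p => w p • μ p
  have m0 : ∀ s, MeasurableSet s → (m s = 0 ↔ ∀ p, μ p s = 0) := by
    intro s hs
    simp only [m, Measure.sum_apply _ hs, ENNReal.tsum_eq_zero, Measure.smul_apply, smul_eq_mul,
      mul_eq_zero]
    exact forall_congr' fun p => by simp [(hw0 p).ne']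
  have hmt : m univ ≠ ⊤ := by
    refine ne_of_lt (lt_of_le_of_lt ?_ (hw.trans ENNReal.one_lt_top))
    simp only [m, Measure.sum_apply _ MeasurableSet.univ, Measure.smul_apply, smul_eq_mul]
    exact ENNReal.tsum_le_tsum fun p => mul_le_of_le_one_right' (h1 p)
  have hmB : m Bᶜ = 0 := (m0 _ hB.compl).2 h3
  have hms : ∀ x, m {x} = 0 := fun x => (m0 _ (measurableSet_singleton x)).2 fun p => h2 p x
  have hmI : ∀ a b : ℝ, m (Ioc a b) = 0 ↔ (Ioo a b ∩ B).Countable := by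
    intro a b
    constructor
    · intro h
      by_contra hc
      obtain ⟨p, hp1, hp2, hp3⟩ := aux_rat B a b hc
      refine h4 p hp3 (measure_mono_null ?_ ((m0 _ measurableSet_Ioc).1 h p))
      intro x hx
      exact ⟨hp1.trans hx.1, (hx.2.trans hp2).le⟩
    · intro h
      have : NullSingletonClass m := ⟨hms⟩
      have : Ioc a b ⊆ (Ioo a b ∩ B) ∪ ({b} ∪ Bᶜ) := by
        intro x hx
        by_cases hxB : x ∈ B
        · rcases hx.2.lt_or_eq with h | h
          · exact Or.inl ⟨⟨hx.1, h⟩, hxB⟩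
          · exact Or.inr (Or.inl h)
        · exact Or.inr (Or.inr hxB)
      exact measure_mono_null this
        (measure_union_null (h.measure_zero m) (measure_union_null (hms b) hmB))
  have hm0 : m univ ≠ 0 := by
    intro h
    apply hu
    have : B ⊆ ⋃ n : ℕ, (Ioo (-(n : ℝ)) n ∩ B) := by
      intro x hx
      obtain ⟨n, hn⟩ := exists_nat_gt |x|
      exact mem_iUnion.2 ⟨n, abs_lt.1 hn, hx⟩
    exact Countable.mono this (countable_iUnion fun n => (hmI _ _).1 (measure_mono_null (subset_univ _) h))
  have hz : ∀ s, ((m univ)⁻¹ • m) s = 0 ↔ m s = 0 := by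
    intro s
    simp [hmt]
  refine ⟨(m univ)⁻¹ • m, ⟨?_⟩, ?_, ?_, ?_⟩
  · simp [ENNReal.inv_mul_cancel hm0 hmt]
  · intro x; rw [hz]; exact hms x
  · rw [hz]; exact hmB
  · intro a b; rw [hz]; exact hmI a b

lemma aux_F (T : ℝ) (hT : 0 < T) (B : Set ℝ) (hB : MeasurableSet B) (hBT : B ⊆ Ioc 0 T)
    (hu : ¬ B.Countable) :
    ∃ F : ℝ → ℝ, Continuous F ∧ Monotone F ∧ F 0 = 0 ∧ F T = T ∧
      ∀ a b, a ≤ b → (F a = F b ↔ (Ioo a b ∩ B).Countable) := by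
  obtain ⟨μ, hp, hs, hc, hI⟩ := aux_measure2 B hB hu
  have hmu : (ProbabilityTheory.cdf μ).measure = μ := ProbabilityTheory.measure_cdf μ
  set f := ProbabilityTheory.cdf μ with hf
  have hcont : Continuous f := by
    rw [continuous_iff_continuousAt]
    intro x
    rw [f.mono.continuousAt_iff_leftLim_eq_rightLim, f.rightLim_eq]
    have := f.measure_singleton x
    rw [hmu, hs x] at this
    have h2 := ENNReal.ofReal_eq_zero.1 this.symm
    exact le_antisymm (f.mono.leftLim_le le_rfl) (by linarith)
  have h0 : f 0 = 0 := by
    have hsub : Iic (0 : ℝ) ⊆ Bᶜ := fun x hx hxB => not_lt.2 (mem_Iic.1 hx) (hBT hxB).1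
    have h : μ (Iic 0) = 0 := measure_mono_null hsub hc
    rw [hf, ProbabilityTheory.cdf_eq_real, measureReal_def, h]
    rfl
  have h1 : f T = 1 := by
    rw [hf, ProbabilityTheory.cdf_eq_real, measureReal_def]
    have : μ (Iic T) = 1 := by
      rw [prob_compl_eq_zero_iff measurableSet_Iic |>.symm]
      exact measure_mono_null (fun x hx hxB => hx (hBT hxB).2) hc
    simp [this]
  refine ⟨fun x => T * f x, continuous_const.mul hcont, fun a b h =>
    mul_le_mul_of_nonneg_left (f.mono h) hT.le, by simp [h0], by simp [h1], ?_⟩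
  intro a b hab
  rw [← hI, ← hmu, f.measure_Ioc, ENNReal.ofReal_eq_zero]
  have := f.mono hab
  constructor
  · intro h
    have := mul_left_cancel₀ hT.ne' h
    linarith
  · intro h
    have : f a = f b := by linarith
    simp [this]

lemma aux_countable {G : Type*} [Group G] {X : Type*} [MetricSpace X] [CompactSpace X]
    [MulAction G X] (hcont : ∀ g : G, Continuous fun x : X => g • x)
    (A : Set X) (hne : A.Nonempty) (hcl : IsClosed A)
    (hinv : ∀ g : G, g • A = A) (hA : A.Countable) :
    ∃ a ∈ A, (MulAction.orbit G a).Finite := by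
  let S : Set (Set X) := {M | IsClosed M ∧ M.Nonempty ∧ ∀ g : G, ∀ x ∈ M, g • x ∈ M}
  obtain ⟨M, hMA, hM⟩ := zorn_superset_nonempty S (by
    intro c hc hch hcne
    have := hcne.to_subtype
    refine ⟨⋂₀ c, ⟨isClosed_sInter fun s hs => (hc hs).1, ?_, ?_⟩, fun s hs => sInter_subset_of_mem hs⟩
    · rw [sInter_eq_iInter]
      refine IsCompact.nonempty_iInter_of_directed_nonempty_isCompact_isClosed _ ?_
        (fun i => (hc i.2).2.1) (fun i => (hc i.2).1.isCompact) (fun i => (hc i.2).1)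
      exact DirectedOn.directed_val (IsChain.directedOn hch.symm)
    · intro g x hx s hs
      exact (hc hs).2.2 g x (hx s hs)) A ⟨hcl, hne, fun g x hx => by
        rw [← hinv g]; exact smul_mem_smul_set hx⟩
  obtain ⟨⟨hMc, ⟨a, ha⟩, hMi⟩, hmin⟩ := hM
  have hD : derivedSet M ⊆ M := (isClosed_iff_derivedSet_subset M).1 hMc
  refine ⟨a, hMA ha, ?_⟩
  rcases (derivedSet M).eq_empty_or_nonempty with h | h
  · have hfin : M.Finite := by
      by_contra hinf
      obtain ⟨x, hx⟩ := Set.Infinite.exists_accPt_principal (s := M) hinf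
      have : x ∈ derivedSet M := hx
      simp [h] at this
    refine hfin.subset ?_
    rintro _ ⟨g, rfl⟩
    exact hMi g a ha
  · exfalso
    have hsub : M ⊆ derivedSet M := by
      refine hmin ⟨isClosed_derivedSet M, h, fun g x hx => ?_⟩ hD
      have h1 : (fun x : X => g • x) '' derivedSet M ⊆ derivedSet ((fun x : X => g • x) '' M) :=
        Continuous.image_derivedSet (hcont g) (MulAction.injective g)
      refine derivedSet_mono _ _ ?_ (h1 ⟨x, hx, rfl⟩)
      rintro _ ⟨y, hy, rfl⟩
      exact hMi g y hy
    have hperf : Perfect M := perfect_iff_eq_derivedSet.2 (hsub.antisymm hD)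
    obtain ⟨f, hf, -, hfi⟩ := hperf.exists_nat_bool_injection ⟨a, ha⟩
    have h1 : (range f).Countable := (hA.mono hMA).mono hf
    have h2 : Countable (ℕ → Bool) := by
      have : Countable (range f) := h1.to_subtype
      exact (Set.rangeFactorization_injective.2 hfi).countable
    have h3 : ¬ Countable ℝ := not_countable
    exact h3 (PolishSpace.measurableEquivNatBoolOfNotCountable h3).injective.countable


lemma aux_sep (T : ℝ) [hT : Fact (0 < T)] (C : Set (AddCircle T)) (hC : IsPreconnected C)
    (a b : ℝ) (ha : 0 ≤ a) (hab : a < b) (hb : b < T)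
    (haC : (a : AddCircle T) ∈ C) (hbC : (b : AddCircle T) ∈ C) :
    (∀ x ∈ Ioo a b, (x : AddCircle T) ∈ C) ∨ (∀ x ∈ Ioo b (a + T), (x : AddCircle T) ∈ C) := by
  by_contra hcon
  push Not at hcon
  obtain ⟨⟨u, hu, huC⟩, v, hv, hvC⟩ := hcon
  have hop : ∀ s : Set ℝ, IsOpen s → IsOpen ((fun x : ℝ => (x : AddCircle T)) '' s) :=
    fun s hs => QuotientAddGroup.isOpenMap_coe s hs
  obtain ⟨z, -, ⟨x, hx, hxz⟩, ⟨y, hy, hyz⟩⟩ := hC _ _ (hop (Ioo u v) isOpen_Ioo) (hop (Ioo v (u + T)) isOpen_Ioo)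
    (by
      intro z hz
      obtain ⟨x, hx, rfl⟩ : ∃ x ∈ Ico u (u + T), (x : AddCircle T) = z :=
        ⟨_, (AddCircle.equivIco T u z).2, AddCircle.coe_equivIco⟩
      have h1 : x ≠ u := by rintro rfl; exact huC hz
      have h2 : x ≠ v := by rintro rfl; exact hvC hz
      have h3 := lt_of_le_of_ne hx.1 h1.symm
      rcases lt_or_gt_of_ne h2 with h | h
      · exact Or.inl ⟨x, ⟨h3, h⟩, rfl⟩
      · exact Or.inr ⟨x, ⟨h, hx.2⟩, rfl⟩)
    ⟨_, hbC, b, ⟨hu.2, hv.1⟩, rfl⟩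
    ⟨_, haC, a + T, ⟨hv.2, by linarith [hu.1]⟩, by simp⟩
  have h1 : u < a + T := by linarith [hu.2]
  have := (AddCircle.coe_eq_coe_iff_of_mem_Ico (p := T) (a := u) (x := x) (y := y)
    ⟨hx.1.le, by linarith [hx.2, hv.2, hu.1]⟩ ⟨by linarith [hy.1, hv.1, hu.2], hy.2⟩).1
    (hxz.trans hyz.symm)
  linarith [hx.2, hy.1]

lemma aux_q (T : ℝ) [hT : Fact (0 < T)] (A : Set (AddCircle T)) (hcl : IsClosed A)
    (hA : ¬ A.Countable) :
    ∃ q : AddCircle T → AddCircle T, Continuous q ∧ q '' A = univ ∧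
      (∀ z, IsPreconnected (q ⁻¹' {z}) ∧ (q ⁻¹' {z} ∩ A).Countable) ∧
      ∀ C : Set (AddCircle T), IsPreconnected C → (C ∩ A).Countable →
        ∀ x ∈ C, ∀ y ∈ C, q x = q y := by
  have hT0 : 0 < T := hT.out
  have hcoe : Continuous (fun x : ℝ => (x : AddCircle T)) := AddCircle.continuous_mk' T
  let A' : Set ℝ := (fun x : ℝ => (x : AddCircle T)) ⁻¹' A
  have hA' : IsClosed A' := hcl.preimage hcoe
  let B : Set ℝ := A' ∩ Ioc 0 T
  have hB : MeasurableSet B := hA'.measurableSet.inter measurableSet_Ioc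
  have hrepIoc : ∀ z : AddCircle T, ∃ x ∈ Ioc 0 T, (x : AddCircle T) = z := fun z =>
    ⟨_, by simpa using (AddCircle.equivIoc T 0 z).2, AddCircle.coe_equivIoc⟩
  have hrepIco : ∀ z : AddCircle T, ∃ x ∈ Ico 0 T, (x : AddCircle T) = z := fun z =>
    ⟨_, by simpa using (AddCircle.equivIco T 0 z).2, AddCircle.coe_equivIco⟩
  have hinj : InjOn (fun x : ℝ => (x : AddCircle T)) (Ioc 0 T) := by
    intro x hx y hy h
    exact (AddCircle.coe_eq_coe_iff_of_mem_Ioc (p := T) (a := 0) (by simpa using hx) (by simpa using hy)).1 h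
  have hBu : ¬ B.Countable := by
    intro h
    apply hA
    refine (h.image (fun x : ℝ => (x : AddCircle T))).mono ?_
    intro z hz
    obtain ⟨x, hx, rfl⟩ := hrepIoc z
    exact ⟨x, ⟨hz, hx⟩, rfl⟩
  obtain ⟨F, hFc, hFm, hF0, hFT, hF⟩ := aux_F T hT0 B hB inter_subset_right hBu
  have hFmem : ∀ x ∈ Icc 0 T, F x ∈ Icc 0 T := fun x hx =>
    ⟨hF0 ▸ hFm hx.1, hFT ▸ hFm hx.2⟩
  have hTz : ((T : ℝ) : AddCircle T) = 0 := AddCircle.coe_period T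
  let q : AddCircle T → AddCircle T := AddCircle.liftIco T 0 (fun x => (F x : AddCircle T))
  have hq : ∀ x ∈ Icc 0 T, q (x : AddCircle T) = (F x : AddCircle T) := by
    intro x hx
    rcases hx.2.lt_or_eq with h | h
    · exact AddCircle.liftIco_coe_apply (by simpa using ⟨hx.1, h⟩)
    · have : q ((0 : ℝ) : AddCircle T) = (F 0 : AddCircle T) :=
        AddCircle.liftIco_coe_apply (by simpa using hT0)
      rw [h, hTz, hFT, hTz]
      simpa [hF0] using this
  have hqc : Continuous q := AddCircle.liftIco_continuous (by simp [hF0, hFT, hTz])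
    (hcoe.comp hFc).continuousOn
  have hqA : q '' A = univ := by
    refine eq_univ_of_forall fun z => ?_
    obtain ⟨t, ht, rfl⟩ := hrepIoc z
    have hK : IsCompact (Icc 0 T ∩ F ⁻¹' {t}) :=
      isCompact_Icc.inter_right (isClosed_singleton.preimage hFc)
    have hKne : (Icc 0 T ∩ F ⁻¹' {t}).Nonempty := by
      obtain ⟨x, hx, h⟩ := intermediate_value_Icc hT0.le hFc.continuousOn
        (show t ∈ Icc (F 0) (F T) by rw [hF0, hFT]; exact ⟨ht.1.le, ht.2⟩)
      exact ⟨x, hx, h⟩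
    obtain ⟨b, ⟨hbI, hbt⟩, hbmin⟩ := hK.exists_isLeast hKne
    have hbt : F b = t := hbt
    have hb0 : 0 < b := by
      rcases hbI.1.lt_or_eq with h | h
      · exact h
      · rw [← h, hF0] at hbt; linarith [ht.1]
    have hbA : b ∈ A' := by
      rw [← hA'.closure_eq, Metric.mem_closure_iff]
      intro ε hε
      set c := max 0 (b - ε) with hc
      have hcb : c < b := max_lt hb0 (by linarith)
      have hne : F c ≠ F b := by
        intro h
        have := hbmin ⟨⟨le_max_left _ _, hcb.le.trans hbI.2⟩, h.trans hbt⟩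
        linarith
      have hnc := fun h => hne ((hF c b hcb.le).2 h)
      obtain ⟨x, hx⟩ : (Ioo c b ∩ B).Nonempty := by
        by_contra h
        rw [not_nonempty_iff_eq_empty] at h
        exact hnc (by rw [h]; exact countable_empty)
      refine ⟨x, hx.2.1, ?_⟩
      have := hx.1.1
      have h3 := hx.1.2
      have : b - ε ≤ c := le_max_right _ _
      rw [Real.dist_eq, abs_lt]
      constructor <;> linarith
    exact ⟨(b : AddCircle T), hbA, by rw [hq b hbI, hbt]⟩
  let K : ℝ → Set (AddCircle T) := fun s => (fun x : ℝ => (x : AddCircle T)) '' (Icc 0 T ∩ F ⁻¹' {s})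
  have hKp : ∀ s, IsPreconnected (K s) := by
    intro s
    refine IsPreconnected.image ?_ _ hcoe.continuousOn
    exact (ordConnected_Icc.inter (ordConnected_singleton.preimage_mono hFm)).isPreconnected
  have hKA : ∀ s, (K s ∩ A).Countable := by
    intro s
    have hK : IsCompact (Icc 0 T ∩ F ⁻¹' {s}) :=
      isCompact_Icc.inter_right (isClosed_singleton.preimage hFc)
    rcases (Icc 0 T ∩ F ⁻¹' {s}).eq_empty_or_nonempty with h | h
    · simp [K, h]
    obtain ⟨a, ⟨haI, has⟩, hamin⟩ := hK.exists_isLeast h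
    obtain ⟨b, ⟨hbI, hbs⟩, hbmax⟩ := hK.exists_isGreatest h
    have hab : a ≤ b := hamin ⟨hbI, hbs⟩
    have hc : (Ioo a b ∩ B).Countable := (hF a b hab).1 (has.trans hbs.symm)
    refine ((hc.image (fun x : ℝ => (x : AddCircle T))).union
      ((countable_singleton (a : AddCircle T)).union (countable_singleton (b : AddCircle T)))).mono ?_
    rintro _ ⟨⟨x, hx, rfl⟩, hxA⟩
    have h1 := hamin hx
    have h2 := hbmax hx
    rcases h1.lt_or_eq with h1 | h1
    · rcases h2.lt_or_eq with h2 | h2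
      · exact Or.inl ⟨x, ⟨⟨h1, h2⟩, hxA, haI.1.trans_lt h1, hx.1.2⟩, rfl⟩
      · exact Or.inr (Or.inr (by simp [h2]))
    · exact Or.inr (Or.inl (by simp [h1]))
  refine ⟨q, hqc, hqA, ?_, ?_⟩
  · intro z
    obtain ⟨t, ht, rfl⟩ := hrepIoc z
    rcases ht.2.lt_or_eq with h | h
    · have : q ⁻¹' {(t : AddCircle T)} = K t := by
        ext w
        constructor
        · intro hw
          obtain ⟨x, hx, rfl⟩ := hrepIco w
          have hx' : x ∈ Icc 0 T := ⟨hx.1, hx.2.le⟩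
          have hw : q (x : AddCircle T) = (t : AddCircle T) := hw
          rw [hq x hx'] at hw
          refine ⟨x, ⟨hx', ?_⟩, rfl⟩
          have hm := hFmem x hx'
          rcases hm.2.lt_or_eq with h' | h'
          · exact (AddCircle.coe_eq_coe_iff_of_mem_Ico (p := T) (a := 0)
              (by simpa using ⟨hm.1, h'⟩) (by simpa using ⟨ht.1.le, h⟩)).1 hw
          · rw [h'] at hw
            have := hinj (show T ∈ Ioc 0 T from ⟨hT0, le_rfl⟩) ht hw
            linarith
        · rintro ⟨x, ⟨hx, hxt⟩, rfl⟩
          have hxt : F x = t := hxt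
          show q (x : AddCircle T) = _
          rw [hq x hx, hxt]
      rw [this]
      exact ⟨hKp t, hKA t⟩
    · have : q ⁻¹' {(t : AddCircle T)} = K 0 ∪ K T := by
        rw [h]
        ext w
        constructor
        · intro hw
          obtain ⟨x, hx, rfl⟩ := hrepIco w
          have hx' : x ∈ Icc 0 T := ⟨hx.1, hx.2.le⟩
          have hw : q (x : AddCircle T) = (T : AddCircle T) := hw
          rw [hq x hx'] at hw
          have hm := hFmem x hx'
          rcases hm.1.lt_or_eq with h' | h'
          · exact Or.inr ⟨x, ⟨hx', hinj ⟨h', hm.2⟩ ⟨hT0, le_rfl⟩ hw⟩, rfl⟩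
          · exact Or.inl ⟨x, ⟨hx', h'.symm⟩, rfl⟩
        · rintro (⟨x, ⟨hx, hxt⟩, rfl⟩ | ⟨x, ⟨hx, hxt⟩, rfl⟩)
          · have hxt : F x = 0 := hxt
            show q (x : AddCircle T) = _
            rw [hq x hx, hxt, hTz]; simp
          · have hxt : F x = T := hxt
            show q (x : AddCircle T) = _
            rw [hq x hx, hxt]
      rw [this]
      refine ⟨IsPreconnected.union ((0 : ℝ) : AddCircle T) ⟨0, ⟨⟨le_rfl, hT0.le⟩, hF0⟩, rfl⟩
        ⟨T, ⟨⟨hT0.le, le_rfl⟩, hFT⟩, by simp⟩ (hKp 0) (hKp T), ?_⟩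
      rw [union_inter_distrib_right]
      exact (hKA 0).union (hKA T)
  · intro C hC hCA
    have main : ∀ a b : ℝ, 0 ≤ a → a < b → b < T → (a : AddCircle T) ∈ C →
        (b : AddCircle T) ∈ C → q (a : AddCircle T) = q (b : AddCircle T) := by
      intro a b ha hab hb haC hbC
      have hcnt : ∀ I : Set ℝ, (∀ x ∈ I, (x : AddCircle T) ∈ C) → (I ∩ B).Countable := by
        intro I hI
        refine MapsTo.countable_of_injOn (f := fun x : ℝ => (x : AddCircle T)) (t := C ∩ A) ?_
          (hinj.mono fun x hx => hx.2.2) hCA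
        intro x hx
        exact ⟨hI x hx.1, hx.2.1⟩
      rw [hq a ⟨ha, (hab.trans hb).le⟩, hq b ⟨ha.trans hab.le, hb.le⟩]
      rcases aux_sep T C hC a b ha hab hb haC hbC with h | h
      · rw [(hF a b hab.le).2 (hcnt _ h)]
      · have h1 : F b = F T := (hF b T hb.le).2 (hcnt _ fun x hx => h x ⟨hx.1, by linarith [hx.2]⟩)
        have h2 : F 0 = F a := (hF 0 a ha).2 (hcnt _ fun x hx => by
          have := h (x + T) ⟨by linarith [hx.1], by linarith [hx.2]⟩
          simpa using this)
        rw [h1, ← h2, hF0, hFT, hTz]; simp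
    intro x hx y hy
    obtain ⟨a, ha, rfl⟩ := hrepIco x
    obtain ⟨b, hb, rfl⟩ := hrepIco y
    rcases lt_trichotomy a b with h | h | h
    · exact main a b ha.1 h hb.2 hx hy
    · rw [h]
    · exact (main b a hb.1 h ha.2 hy hx).symm

/-- If a group `G` acts by homeomorphisms on the circle and `A` is a nonempty closed
`G`-invariant subset, then either `A` is countable and `G` virtually fixes a point of `A`
(some point of `A` has finite orbit), or there is a `G`-equivariant cellular quotient map
`q : S¹ → S¹` with `q(A) = S¹`. -/
theorem stmt0 {G : Type*} [Group G] [MulAction G S1]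
    (hcont : ∀ g : G, Continuous fun x : S1 => g • x)
    (A : Set S1) (hne : A.Nonempty) (hcl : IsClosed A)
    (hinv : ∀ g : G, g • A = A) :
    (A.Countable ∧ ∃ a ∈ A, (MulAction.orbit G a).Finite) ∨
    (∃ q : S1 → S1, Continuous q ∧ Function.Surjective q ∧
      (∀ z : S1, IsCompact (q ⁻¹' {z}) ∧ IsConnected (q ⁻¹' {z})) ∧
      q '' A = Set.univ ∧
      ∀ g : G, ∃ φ : S1 ≃ₜ S1, q ∘ (fun x => g • x) = ⇑φ ∘ q) := by
  have hT : Fact (0 < 2 * Real.pi) := ⟨Real.two_pi_pos⟩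
  by_cases hA : A.Countable
  · exact Or.inl ⟨hA, aux_countable hcont A hne hcl hinv hA⟩
  right
  obtain ⟨q, hqc, hqA, hfib, hconst⟩ := aux_q (2 * Real.pi) A hcl hA
  have hsurj : Function.Surjective q := by
    intro z
    have : z ∈ q '' A := by rw [hqA]; trivial
    obtain ⟨x, -, hx⟩ := this
    exact ⟨x, hx⟩
  have hquot : IsQuotientMap q := hqc.isClosedMap.isQuotientMap hqc hsurj
  refine ⟨q, hqc, hsurj, fun z => ⟨(isClosed_singleton.preimage hqc).isCompact, ?_, (hfib z).1⟩,
    hqA, ?_⟩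
  · obtain ⟨x, hx⟩ := hsurj z
    exact ⟨x, hx⟩
  have hdesc : ∀ g : G, ∀ x y : S1, q x = q y → q (g • x) = q (g • y) := by
    intro g x y hxy
    refine hconst ((fun x : S1 => g • x) '' (q ⁻¹' {q y}))
      ((hfib (q y)).1.image _ (hcont g).continuousOn) ?_ _ ⟨x, hxy, rfl⟩ _ ⟨y, rfl, rfl⟩
    refine ((hfib (q y)).2.image (fun x : S1 => g • x)).mono ?_
    rintro _ ⟨⟨w, hw, rfl⟩, hwA⟩
    refine ⟨w, ⟨hw, ?_⟩, rfl⟩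
    have hwA : g • w ∈ A := hwA
    rw [← hinv g] at hwA
    exact smul_mem_smul_set_iff.1 hwA
  let s := Function.surjInv hsurj
  have hs : ∀ z, q (s z) = z := Function.surjInv_eq hsurj
  let ψ : G → S1 → S1 := fun g z => q (g • s z)
  have hψ : ∀ g x, ψ g (q x) = q (g • x) := fun g x => hdesc g _ _ (hs (q x))
  have hψc : ∀ g, Continuous (ψ g) := by
    intro g
    rw [hquot.continuous_iff]
    have : ψ g ∘ q = q ∘ fun x => g • x := funext fun x => hψ g x
    rw [this]
    exact hqc.comp (hcont g)
  have hinv' : ∀ g h : G, h * g = 1 → ∀ z, ψ h (ψ g z) = z := by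
    intro g h hgh z
    obtain ⟨x, rfl⟩ := hsurj z
    rw [hψ g x, hψ h, smul_smul, hgh, one_smul]
  intro g
  refine ⟨{ toFun := ψ g, invFun := ψ g⁻¹, left_inv := hinv' _ _ (by simp),
            right_inv := hinv' _ _ (by simp), continuous_toFun := hψc _,
            continuous_invFun := hψc _ }, ?_⟩
  funext x
  exact (hψ g x).symm
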